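/- Recovery of the Hamiltonian solution from the unified formalism (coordinate version of Theorem 4, item 2): Let L : J → ℝ be a smooth hyperregular Lagrangian with associated Hamiltonian h. If (y, v, p) is a critical unified section, then the pair (y, p) satisfies the Hamilton–De Donder–Weyl equations for h at every point. -/

import Mathlib

open MeasureTheory

/-- Partial derivative of a real-valued function on `Fin m → ℝ` in the `ν`-th
coordinate direction. -/
noncomputable def pd {m : ℕ} (f : (Fin m → ℝ) → ℝ) (ν : Fin m) (x : Fin m → ℝ) : ℝ :=
  fderiv ℝ f x (Pi.single ν 1)

/-- First jet prolongation of `φ`. -/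
noncomputable def j1 {m n : ℕ} (φ : (Fin m → ℝ) → (Fin n → ℝ)) (x : Fin m → ℝ) :
    (Fin m → ℝ) × (Fin n → ℝ) × (Fin n → Fin m → ℝ) :=
  (x, φ x, fun A ν => pd (fun x' => φ x' A) ν x)

/-- Partial derivative of the Lagrangian in the `y^A` slot. -/
noncomputable def Ly {m n : ℕ} (L : (Fin m → ℝ) × (Fin n → ℝ) × (Fin n → Fin m → ℝ) → ℝ)
    (z : (Fin m → ℝ) × (Fin n → ℝ) × (Fin n → Fin m → ℝ)) (A : Fin n) : ℝ :=
  fderiv ℝ L z (0, Pi.single A 1, 0)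

/-- Partial derivative of the Lagrangian in the `v^A_ν` slot. -/
noncomputable def Lv {m n : ℕ} (L : (Fin m → ℝ) × (Fin n → ℝ) × (Fin n → Fin m → ℝ) → ℝ)
    (z : (Fin m → ℝ) × (Fin n → ℝ) × (Fin n → Fin m → ℝ)) (A : Fin n) (ν : Fin m) : ℝ :=
  fderiv ℝ L z (0, 0, Pi.single A (Pi.single ν 1))


/-- The unified (Lagrange–Hamilton) action density. -/
noncomputable def U {m n : ℕ} (L : (Fin m → ℝ) × (Fin n → ℝ) × (Fin n → Fin m → ℝ) → ℝ)
    (y : (Fin m → ℝ) → (Fin n → ℝ)) (v p : (Fin m → ℝ) → (Fin n → Fin m → ℝ))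
    (x : Fin m → ℝ) : ℝ :=
  L (x, y x, v x) +
    ∑ A : Fin n, ∑ ν : Fin m, p x A ν * (pd (fun x' => y x' A) ν x - v x A ν)

/-- `(y, v, p)` is a critical section of the unified action. -/
noncomputable def CriticalUnified {m n : ℕ}
    (L : (Fin m → ℝ) × (Fin n → ℝ) × (Fin n → Fin m → ℝ) → ℝ)
    (y : (Fin m → ℝ) → (Fin n → ℝ)) (v p : (Fin m → ℝ) → (Fin n → Fin m → ℝ)) : Prop :=
  ∀ (Z : (Fin m → ℝ) → (Fin n → ℝ)) (V W : (Fin m → ℝ) → (Fin n → Fin m → ℝ)),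
    ContDiff ℝ (⊤ : ℕ∞) Z → HasCompactSupport Z → ContDiff ℝ (⊤ : ℕ∞) V → HasCompactSupport V →
    ContDiff ℝ (⊤ : ℕ∞) W → HasCompactSupport W →
    HasDerivAt
      (fun t : ℝ => ∫ x : Fin m → ℝ,
        (U L (y + t • Z) (v + t • V) (p + t • W) x - U L y v p x)) 0 0

/-- The Legendre map associated with the Lagrangian `L`. -/
noncomputable def FL {m n : ℕ} (L : (Fin m → ℝ) × (Fin n → ℝ) × (Fin n → Fin m → ℝ) → ℝ)
    (z : (Fin m → ℝ) × (Fin n → ℝ) × (Fin n → Fin m → ℝ)) :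
    (Fin m → ℝ) × (Fin n → ℝ) × (Fin n → Fin m → ℝ) :=
  (z.1, z.2.1, fun A ν => Lv L z A ν)

/-- The integral of the increment of a one-parameter family of densities whose `t`-derivative is
jointly continuous and vanishes off a fixed compact set has the expected derivative at `0`. -/
theorem hasDerivAt_integral_sub_of_compact {X : Type*} [TopologicalSpace X] [T2Space X]
    [MeasurableSpace X] [OpensMeasurableSpace X] [SecondCountableTopology X] {μ : Measure X}
    [IsFiniteMeasureOnCompacts μ] {F F' : ℝ → X → ℝ} {K : Set X} (hK : IsCompact K)
    (hF : ∀ t, Continuous (F t)) (hF' : Continuous (Function.uncurry F'))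
    (hderiv : ∀ t x, HasDerivAt (fun s => F s x) (F' t x) t)
    (hzero : ∀ t, ∀ x ∉ K, F' t x = 0) :
    HasDerivAt (fun t => ∫ x, (F t x - F 0 x) ∂μ) (∫ x, F' 0 x ∂μ) 0 := by
  obtain ⟨C, hC⟩ :=
    ((isCompact_closedBall (0 : ℝ) 1).prod hK).exists_bound_of_continuousOn hF'.continuousOn
  refine (hasDerivAt_integral_of_dominated_loc_of_deriv_le (μ := μ) (𝕜 := ℝ) (x₀ := (0 : ℝ))
    (F := fun t x => F t x - F 0 x) (F' := F') (bound := K.indicator fun _ => C)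
    (Metric.closedBall_mem_nhds (0 : ℝ) one_pos) ?_ ?_ ?_ ?_ ?_ ?_).2
  · exact .of_forall fun t => ((hF t).sub (hF 0)).aestronglyMeasurable
  · simp
  · exact (hF'.comp (Continuous.prodMk_right (0 : ℝ))).aestronglyMeasurable
  · refine .of_forall fun x t ht => ?_
    by_cases hx : x ∈ K
    · simpa [hx] using hC (t, x) ⟨ht, hx⟩
    · simp [hx, hzero t x hx]
  · exact (integrable_indicator_iff hK.measurableSet).2 (integrableOn_const hK.measure_lt_top.ne)
  · exact .of_forall fun x t _ => (hderiv t x).sub_const _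

/-- Fundamental lemma of the calculus of variations for continuous functions. -/
theorem eq_zero_of_integral_contDiff_mul_eq_zero {m : ℕ} {f : (Fin m → ℝ) → ℝ} (hf : Continuous f)
    (h : ∀ g : (Fin m → ℝ) → ℝ, ContDiff ℝ (⊤ : ℕ∞) g → HasCompactSupport g →
      ∫ x, g x * f x = 0) (x : Fin m → ℝ) : f x = 0 :=
  congrFun (Continuous.ae_eq_iff_eq volume hf (continuous_const (y := (0 : ℝ))) |>.1
    (ae_eq_zero_of_integral_contDiff_smul_eq_zero hf.locallyIntegrable h)) x

theorem continuous_pd {m : ℕ} {f : (Fin m → ℝ) → ℝ} (hf : ContDiff ℝ (⊤ : ℕ∞) f) (ν : Fin m) :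
    Continuous (pd f ν) :=
  (hf.continuous_fderiv (by simp)).clm_apply continuous_const

theorem pd_eq_zero_of_notMem_tsupport {m : ℕ} {f : (Fin m → ℝ) → ℝ} {x : Fin m → ℝ}
    (hx : x ∉ tsupport f) (ν : Fin m) : pd f ν x = 0 := by
  rw [pd, fderiv_of_notMem_tsupport ℝ hx, zero_apply]

theorem pd_add_const_mul {m : ℕ} {f g : (Fin m → ℝ) → ℝ} (hf : Differentiable ℝ f)
    (hg : Differentiable ℝ g) (t : ℝ) (ν : Fin m) (x : Fin m → ℝ) :
    pd (fun x' => f x' + t * g x') ν x = pd f ν x + t * pd g ν x := by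
  simp [pd, fderiv_fun_add (hf x) ((hg x).const_mul t), fderiv_const_mul (hg x)]

theorem integral_mul_pd_eq_neg {m : ℕ} {f g : (Fin m → ℝ) → ℝ} (hf : ContDiff ℝ (⊤ : ℕ∞) f)
    (hg : ContDiff ℝ (⊤ : ℕ∞) g) (hgc : HasCompactSupport g) (ν : Fin m) :
    ∫ x, f x * pd g ν x = - ∫ x, pd f ν x * g x := by
  have hpg : HasCompactSupport (pd g ν) :=
    hgc.mono' fun x hx => not_not.1 fun h => hx (pd_eq_zero_of_notMem_tsupport h ν)
  exact integral_mul_fderiv_eq_neg_fderiv_mul_of_integrable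
    (((continuous_pd hf ν).mul hg.continuous).integrable_of_hasCompactSupport hgc.mul_left)
    ((hf.continuous.mul (continuous_pd hg ν)).integrable_of_hasCompactSupport hpg.mul_left)
    ((hf.continuous.mul hg.continuous).integrable_of_hasCompactSupport hgc.mul_left)
    (fun x _ => hf.differentiable (by simp) x) (fun x _ => hg.differentiable (by simp) x)

/-- The differential of a function on jet space in a `v`-direction, in coordinates. -/
theorem fderiv_apply_eq_sum_Lv {m n : ℕ}
    (L : (Fin m → ℝ) × (Fin n → ℝ) × (Fin n → Fin m → ℝ) → ℝ)
    (z : (Fin m → ℝ) × (Fin n → ℝ) × (Fin n → Fin m → ℝ)) (w : Fin n → Fin m → ℝ) :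
    fderiv ℝ L z (0, 0, w) = ∑ A, ∑ ν, Lv L z A ν * w A ν := by
  set φ := (fderiv ℝ L z).comp ((ContinuousLinearMap.inr ℝ (Fin m → ℝ) _).comp
    (ContinuousLinearMap.inr ℝ (Fin n → ℝ) (Fin n → Fin m → ℝ))) with hφ
  have hw : w = ∑ A, ∑ ν, w A ν • Pi.single A (Pi.single ν (1 : ℝ)) := by
    ext B κ
    simp [Finset.sum_apply, Pi.single_apply, apply_ite, ite_apply]
  calc fderiv ℝ L z (0, 0, w) = φ w := rfl
    _ = ∑ A, ∑ ν, w A ν * φ (Pi.single A (Pi.single ν (1 : ℝ))) := by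
      conv_lhs => rw [hw]
      simp only [map_sum, map_smul, smul_eq_mul]
    _ = _ := Finset.sum_congr rfl fun A _ => Finset.sum_congr rfl fun ν _ => mul_comm _ _

/-- The differential of the Hamiltonian: the contribution of the inverse Legendre map cancels. -/
theorem fderiv_hamiltonian_apply {m n : ℕ}
    {L : (Fin m → ℝ) × (Fin n → ℝ) × (Fin n → Fin m → ℝ) → ℝ} (hL : ContDiff ℝ (⊤ : ℕ∞) L)
    {G : (Fin m → ℝ) × (Fin n → ℝ) × (Fin n → Fin m → ℝ) →
      (Fin m → ℝ) × (Fin n → ℝ) × (Fin n → Fin m → ℝ)} (hG : ContDiff ℝ (⊤ : ℕ∞) G)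
    (hright : Function.RightInverse G (FL L))
    {h : (Fin m → ℝ) × (Fin n → ℝ) × (Fin n → Fin m → ℝ) → ℝ}
    (hdef : ∀ z : (Fin m → ℝ) × (Fin n → ℝ) × (Fin n → Fin m → ℝ),
      h z = (∑ A : Fin n, ∑ ν : Fin m, z.2.2 A ν * (G z).2.2 A ν) - L (z.1, z.2.1, (G z).2.2))
    (z d : (Fin m → ℝ) × (Fin n → ℝ) × (Fin n → Fin m → ℝ)) :
    fderiv ℝ h z d =
      (∑ A, ∑ ν, d.2.2 A ν * (G z).2.2 A ν) - fderiv ℝ L (G z) (d.1, d.2.1, 0) := by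
  have hz := hright z
  have hGz : (z.1, z.2.1, (G z).2.2) = G z :=
    Prod.ext (congrArg Prod.fst hz).symm
      (Prod.ext (congrArg (fun q => q.2.1) hz).symm rfl)
  have hp : ∀ A ν, Lv L (G z) A ν = z.2.2 A ν := fun A ν =>
    congrFun (congrFun (congrArg (fun q => q.2.2) hz) A) ν
  have hid := hasFDerivAt_id (𝕜 := ℝ) z
  have hGd := (hG.differentiable (by simp) z).hasFDerivAt
  have hLd := (hL.differentiable (by simp) (z.1, z.2.1, (G z).2.2)).hasFDerivAt
  have hcomp := hLd.comp z (hid.fst.prodMk (hid.snd.fst.prodMk hGd.snd.snd))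
  have hpA := fun A ν => hasFDerivAt_pi'.1 (hasFDerivAt_pi'.1 hid.snd.snd A) ν
  have hvA := fun A ν => hasFDerivAt_pi'.1 (hasFDerivAt_pi'.1 hGd.snd.snd A) ν
  have hsum := HasFDerivAt.fun_sum (u := Finset.univ) fun A _ =>
    HasFDerivAt.fun_sum (u := Finset.univ) fun ν _ => (hpA A ν).mul (hvA A ν)
  have hsplit : ∀ w : Fin n → Fin m → ℝ, fderiv ℝ L (G z) (d.1, d.2.1, w) =
      fderiv ℝ L (G z) (d.1, d.2.1, 0) + ∑ A, ∑ ν, z.2.2 A ν * w A ν := fun w => by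
    simp only [← hp]
    rw [← fderiv_apply_eq_sum_Lv, ← map_add]
    simp
  rw [((hsum.sub hcomp).congr_of_eventuallyEq (f₁ := h) (.of_forall hdef)).fderiv, hGz]
  have := hsplit (fderiv ℝ G z d).2.2
  simp [this, Finset.sum_add_distrib, mul_comm]
  ring

/-- First variation formula for the unified action. -/
theorem CriticalUnified.integral_eq_zero {m n : ℕ}
    {L : (Fin m → ℝ) × (Fin n → ℝ) × (Fin n → Fin m → ℝ) → ℝ} (hL : ContDiff ℝ (⊤ : ℕ∞) L)
    {y : (Fin m → ℝ) → (Fin n → ℝ)} (hy : ContDiff ℝ (⊤ : ℕ∞) y)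
    {v p : (Fin m → ℝ) → (Fin n → Fin m → ℝ)} (hv : ContDiff ℝ (⊤ : ℕ∞) v)
    (hp : ContDiff ℝ (⊤ : ℕ∞) p) (hcrit : CriticalUnified L y v p)
    {Z : (Fin m → ℝ) → (Fin n → ℝ)} {V W : (Fin m → ℝ) → (Fin n → Fin m → ℝ)}
    (hZ : ContDiff ℝ (⊤ : ℕ∞) Z) (hZc : HasCompactSupport Z) (hV : ContDiff ℝ (⊤ : ℕ∞) V)
    (hVc : HasCompactSupport V) (hW : ContDiff ℝ (⊤ : ℕ∞) W) (hWc : HasCompactSupport W) :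
    ∫ x, (fderiv ℝ L (x, y x, v x) (0, Z x, V x) + ∑ A, ∑ ν,
      (W x A ν * (pd (fun x' => y x' A) ν x - v x A ν) +
        p x A ν * (pd (fun x' => Z x' A) ν x - V x A ν))) = 0 := by
  have hyA : ∀ A, ContDiff ℝ (⊤ : ℕ∞) fun x => y x A := contDiff_pi.1 hy
  have hZA : ∀ A, ContDiff ℝ (⊤ : ℕ∞) fun x => Z x A := contDiff_pi.1 hZ
  have hpdy := fun A ν => continuous_pd (hyA A) ν
  have hpdZ := fun A ν => continuous_pd (hZA A) ν
  have hLc := hL.continuous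
  have hL' := hL.continuous_fderiv (by simp)
  have hyc := hy.continuous
  have hvc := hv.continuous
  have hpc := hp.continuous
  have hZc' := hZ.continuous
  have hVc' := hV.continuous
  have hWc' := hW.continuous
  let F : ℝ → (Fin m → ℝ) → ℝ := fun t x => L (x, y x + t • Z x, v x + t • V x) +
    ∑ A, ∑ ν, (p x A ν + t * W x A ν) * ((pd (fun x' => y x' A) ν x +
      t * pd (fun x' => Z x' A) ν x) - (v x A ν + t * V x A ν))
  let F' : ℝ → (Fin m → ℝ) → ℝ := fun t x =>
    fderiv ℝ L (x, y x + t • Z x, v x + t • V x) (0, Z x, V x) +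
    ∑ A, ∑ ν, (W x A ν * ((pd (fun x' => y x' A) ν x +
      t * pd (fun x' => Z x' A) ν x) - (v x A ν + t * V x A ν)) +
      (p x A ν + t * W x A ν) * (pd (fun x' => Z x' A) ν x - V x A ν))
  have hUF : ∀ t x, U L (y + t • Z) (v + t • V) (p + t • W) x = F t x := fun t x => by
    have hpd : ∀ A ν, pd (fun x' => (y + t • Z) x' A) ν x = _ := fun A ν =>
      pd_add_const_mul ((hyA A).differentiable (by simp)) ((hZA A).differentiable (by simp)) t ν x
    simp only [U, hpd, F]
    rfl
  have hF : ∀ t, Continuous (F t) := fun t => by fun_prop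
  have hF' : Continuous (Function.uncurry F') := by
    simp only [F', Function.uncurry_def]
    refine .add (.clm_apply (by fun_prop) (by fun_prop)) ?_
    fun_prop
  have hderiv : ∀ t x, HasDerivAt (fun s => F s x) (F' t x) t := fun t x => by
    have hlin : ∀ a b : ℝ, HasDerivAt (fun s => a + s * b) b t := fun a b => by
      simpa using ((hasDerivAt_id t).mul_const b).const_add a
    have hline : HasDerivAt (fun s : ℝ => (x, y x + s • Z x, v x + s • V x)) (0, Z x, V x) t := by
      refine (hasDerivAt_const t x).prodMk (.prodMk ?_ ?_)
      · simpa using ((hasDerivAt_id t).smul_const (Z x)).const_add (y x)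
      · simpa using ((hasDerivAt_id t).smul_const (V x)).const_add (v x)
    have hLd := (hL.differentiable (by simp)
      (x, y x + t • Z x, v x + t • V x)).hasFDerivAt.comp_hasDerivAt t hline
    exact hLd.add (.fun_sum fun A _ => .fun_sum fun ν _ =>
      (hlin _ _).mul ((hlin _ _).sub (hlin _ _)))
  have hzero : ∀ t, ∀ x ∉ tsupport Z ∪ (tsupport V ∪ tsupport W), F' t x = 0 := fun t x hx => by
    simp only [Set.mem_union, not_or] at hx
    have hpd : ∀ A ν, pd (fun x' => Z x' A) ν x = 0 := fun A ν =>
      pd_eq_zero_of_notMem_tsupport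
        (fun hA => hx.1 (tsupport_comp_subset (g := fun w : Fin n → ℝ => w A) rfl Z hA)) ν
    have h0 : ((0, 0, 0) : (Fin m → ℝ) × (Fin n → ℝ) × (Fin n → Fin m → ℝ)) = 0 := rfl
    simp [F', hpd, image_eq_zero_of_notMem_tsupport hx.1,
      image_eq_zero_of_notMem_tsupport hx.2.1, image_eq_zero_of_notMem_tsupport hx.2.2, h0]
  have hvar := hasDerivAt_integral_sub_of_compact (μ := volume)
    (hZc.isCompact.union (hVc.isCompact.union hWc.isCompact)) hF hF' hderiv hzero
  have hU0 : ∀ x, U L y v p x = F 0 x := fun x => by simpa using hUF 0 x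
  have hc := hcrit Z V W hZ hZc hV hVc hW hWc
  simp only [hUF, hU0] at hc
  simpa [F'] using hvar.unique hc

/-- Varying `p`: a critical unified section is holonomic. -/
theorem CriticalUnified.pd_eq {m n : ℕ}
    {L : (Fin m → ℝ) × (Fin n → ℝ) × (Fin n → Fin m → ℝ) → ℝ} (hL : ContDiff ℝ (⊤ : ℕ∞) L)
    {y : (Fin m → ℝ) → (Fin n → ℝ)} (hy : ContDiff ℝ (⊤ : ℕ∞) y)
    {v p : (Fin m → ℝ) → (Fin n → Fin m → ℝ)} (hv : ContDiff ℝ (⊤ : ℕ∞) v)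
    (hp : ContDiff ℝ (⊤ : ℕ∞) p) (hcrit : CriticalUnified L y v p)
    (x : Fin m → ℝ) (A : Fin n) (ν : Fin m) :
    pd (fun x' => y x' A) ν x = v x A ν := by
  have hvc := hv.continuous
  have hpdy := continuous_pd (contDiff_pi.1 hy A) ν
  refine sub_eq_zero.1 (eq_zero_of_integral_contDiff_mul_eq_zero
    (f := fun x => pd (fun x' => y x' A) ν x - v x A ν) (by fun_prop) (fun g hg hgc => ?_) x)
  have key := hcrit.integral_eq_zero hL hy hv hp (Z := 0) (V := 0)
    (W := fun x => g x • Pi.single A (Pi.single ν (1 : ℝ)))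
    contDiff_const .zero contDiff_const .zero (hg.smul contDiff_const) hgc.smul_right
  have h0 : ((0, 0, 0) : (Fin m → ℝ) × (Fin n → ℝ) × (Fin n → Fin m → ℝ)) = 0 := rfl
  have hpd0 : ∀ (κ : Fin m) x, pd (fun _ => (0 : ℝ)) κ x = 0 := fun κ x => by simp [pd]
  rw [← key]
  congr 1 with x
  simp [h0, hpd0, Pi.single_apply, ite_apply, apply_ite, ite_mul]

/-- Varying `v`: the momenta of a critical unified section are given by the Legendre map. -/
theorem CriticalUnified.eq_Lv {m n : ℕ}
    {L : (Fin m → ℝ) × (Fin n → ℝ) × (Fin n → Fin m → ℝ) → ℝ} (hL : ContDiff ℝ (⊤ : ℕ∞) L)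
    {y : (Fin m → ℝ) → (Fin n → ℝ)} (hy : ContDiff ℝ (⊤ : ℕ∞) y)
    {v p : (Fin m → ℝ) → (Fin n → Fin m → ℝ)} (hv : ContDiff ℝ (⊤ : ℕ∞) v)
    (hp : ContDiff ℝ (⊤ : ℕ∞) p) (hcrit : CriticalUnified L y v p)
    (x : Fin m → ℝ) (A : Fin n) (ν : Fin m) :
    Lv L (x, y x, v x) A ν = p x A ν := by
  have hyc := hy.continuous
  have hvc := hv.continuous
  have hpc := hp.continuous
  have hL' := hL.continuous_fderiv (by simp)
  have hLv : Continuous fun x => Lv L (x, y x, v x) A ν :=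
    .clm_apply (by fun_prop) continuous_const
  refine sub_eq_zero.1 (eq_zero_of_integral_contDiff_mul_eq_zero
    (f := fun x => Lv L (x, y x, v x) A ν - p x A ν) (by fun_prop) (fun g hg hgc => ?_) x)
  have key := hcrit.integral_eq_zero hL hy hv hp (Z := 0) (W := 0)
    (V := fun x => g x • Pi.single A (Pi.single ν (1 : ℝ)))
    contDiff_const .zero (hg.smul contDiff_const) hgc.smul_right contDiff_const .zero
  have hpd0 : ∀ (κ : Fin m) x, pd (fun _ => (0 : ℝ)) κ x = 0 := fun κ x => by simp [pd]
  rw [← key]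
  congr 1 with x
  simp [fderiv_apply_eq_sum_Lv, hpd0, Pi.single_apply, ite_apply, apply_ite]
  ring

/-- Varying `y`: the divergence of the momenta of a critical unified section. -/
theorem CriticalUnified.sum_pd_eq {m n : ℕ}
    {L : (Fin m → ℝ) × (Fin n → ℝ) × (Fin n → Fin m → ℝ) → ℝ} (hL : ContDiff ℝ (⊤ : ℕ∞) L)
    {y : (Fin m → ℝ) → (Fin n → ℝ)} (hy : ContDiff ℝ (⊤ : ℕ∞) y)
    {v p : (Fin m → ℝ) → (Fin n → Fin m → ℝ)} (hv : ContDiff ℝ (⊤ : ℕ∞) v)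
    (hp : ContDiff ℝ (⊤ : ℕ∞) p) (hcrit : CriticalUnified L y v p)
    (x : Fin m → ℝ) (A : Fin n) :
    ∑ ν, pd (fun x' => p x' A ν) ν x = Ly L (x, y x, v x) A := by
  have hyc := hy.continuous
  have hvc := hv.continuous
  have hL' := hL.continuous_fderiv (by simp)
  have hLy : Continuous fun x => Ly L (x, y x, v x) A :=
    .clm_apply (by fun_prop) continuous_const
  have hpA : ∀ ν, ContDiff ℝ (⊤ : ℕ∞) fun x => p x A ν :=
    fun ν => contDiff_pi.1 (contDiff_pi.1 hp A) ν
  have hpdp := fun ν => continuous_pd (hpA ν) ν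
  refine (sub_eq_zero.1 (eq_zero_of_integral_contDiff_mul_eq_zero
    (f := fun x => Ly L (x, y x, v x) A - ∑ ν, pd (fun x' => p x' A ν) ν x)
    (by fun_prop) (fun g hg hgc => ?_) x)).symm
  have key := hcrit.integral_eq_zero hL hy hv hp (V := 0) (W := 0)
    (Z := fun x => g x • Pi.single A (1 : ℝ))
    (hg.smul contDiff_const) hgc.smul_right contDiff_const .zero contDiff_const .zero
  have hpdg : ∀ (B : Fin n) (κ : Fin m) x, pd (fun x' => (g x' • Pi.single A (1 : ℝ) :
      Fin n → ℝ) B) κ x = if B = A then pd g κ x else 0 := fun B κ x => by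
    by_cases hB : B = A
    · subst hB; simp
    · simp [pd, hB]
  have hfd : ∀ x, fderiv ℝ L (x, y x, v x) (0, g x • Pi.single A (1 : ℝ), 0) =
      g x * Ly L (x, y x, v x) A := fun x => by
    rw [Ly, ← smul_eq_mul, ← map_smul]
    simp
  have hgpd : ∀ ν, HasCompactSupport (pd g ν) := fun ν =>
    hgc.mono' fun x hx => not_not.1 fun h => hx (pd_eq_zero_of_notMem_tsupport h ν)
  have hint1 : Integrable fun x => g x * Ly L (x, y x, v x) A :=
    (hg.continuous.mul hLy).integrable_of_hasCompactSupport hgc.mul_right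
  have hint2 : ∀ ν, Integrable fun x => p x A ν * pd g ν x := fun ν =>
    ((hpA ν).continuous.mul (continuous_pd hg ν)).integrable_of_hasCompactSupport
      (hgpd ν).mul_left
  have hint3 : ∀ ν, Integrable fun x => pd (fun x' => p x' A ν) ν x * g x := fun ν =>
    ((hpdp ν).mul hg.continuous).integrable_of_hasCompactSupport hgc.mul_left
  have key' : ∫ x, (g x * Ly L (x, y x, v x) A + ∑ ν, p x A ν * pd g ν x) = 0 := by
    rw [← key]
    congr 1 with x
    simp only [hpdg]
    simp [hfd]
  rw [integral_add hint1 (integrable_finsetSum _ fun ν _ => hint2 ν),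
    integral_finsetSum _ fun ν _ => hint2 ν] at key'
  simp only [integral_mul_pd_eq_neg (hpA _) hg hgc] at key'
  simp only [mul_sub, Finset.mul_sum, mul_comm (g _) (pd _ _ _)]
  rw [integral_sub hint1 (integrable_finsetSum _ fun ν _ => hint3 ν),
    integral_finsetSum _ fun ν _ => hint3 ν, ← key', Finset.sum_neg_distrib, sub_eq_add_neg]

/-- Recovery of the Hamiltonian solution from the unified formalism. -/
theorem critical_unified_section_implies_HDW
    (m n : ℕ) (hm : 0 < m) (hn : 0 < n)
    (L : (Fin m → ℝ) × (Fin n → ℝ) × (Fin n → Fin m → ℝ) → ℝ) (hL : ContDiff ℝ (⊤ : ℕ∞) L)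
    -- hyperregularity: the Legendre map is a bijection with smooth inverse
    (FLinv : (Fin m → ℝ) × (Fin n → ℝ) × (Fin n → Fin m → ℝ) →
      (Fin m → ℝ) × (Fin n → ℝ) × (Fin n → Fin m → ℝ))
    (hFLinv : ContDiff ℝ (⊤ : ℕ∞) FLinv)
    (hleft : Function.LeftInverse FLinv (FL L))
    (hright : Function.RightInverse FLinv (FL L))
    -- the associated Hamiltonian
    (h : (Fin m → ℝ) × (Fin n → ℝ) × (Fin n → Fin m → ℝ) → ℝ)
    (hdef : ∀ z : (Fin m → ℝ) × (Fin n → ℝ) × (Fin n → Fin m → ℝ),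
      h z = (∑ A : Fin n, ∑ ν : Fin m, z.2.2 A ν * (FLinv z).2.2 A ν)
        - L (z.1, z.2.1, (FLinv z).2.2))
    (y : (Fin m → ℝ) → (Fin n → ℝ)) (hy : ContDiff ℝ (⊤ : ℕ∞) y)
    (v : (Fin m → ℝ) → (Fin n → Fin m → ℝ)) (hv : ContDiff ℝ (⊤ : ℕ∞) v)
    (p : (Fin m → ℝ) → (Fin n → Fin m → ℝ)) (hp : ContDiff ℝ (⊤ : ℕ∞) p)
    (hcrit : CriticalUnified L y v p) :
    (∀ (x : Fin m → ℝ) (A : Fin n) (ν : Fin m),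
      pd (fun x' => y x' A) ν x = Lv h (x, y x, p x) A ν) ∧
    (∀ (x : Fin m → ℝ) (A : Fin n),
      ∑ ν : Fin m, pd (fun x' => p x' A ν) ν x = - Ly h (x, y x, p x) A) := by
  have hG : ∀ x, FLinv (x, y x, p x) = (x, y x, v x) := fun x => by
    rw [← hleft (x, y x, v x)]
    congr 1
    simp [FL, hcrit.eq_Lv hL hy hv hp]
  have hfd := fderiv_hamiltonian_apply hL hFLinv hright hdef
  refine ⟨fun x A ν => ?_, fun x A => ?_⟩
  · have h0 : ((0, 0, 0) : (Fin m → ℝ) × (Fin n → ℝ) × (Fin n → Fin m → ℝ)) = 0 := rfl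
    rw [hcrit.pd_eq hL hy hv hp, Lv, hfd, hG]
    simp [h0, Pi.single_apply, ite_apply, ite_mul]
  · rw [hcrit.sum_pd_eq hL hy hv hp, Ly, Ly, hfd, hG]
    simp
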